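/- Let k be an algebraically closed field of characteristic p > 0, let e ≥ 1, set q = pᵉ and d = q+1. Then the Fermat polynomial f = x^{q+1}+y^{q+1}+z^{q+1}+w^{q+1} defines a smooth surface S = V(f) ⊆ P³ (f and its partial derivatives have no common zero in k⁴ ∖ {0}), and the set of lines on S has cardinality exactly d²(d²−3d+3). -/

import Mathlib

open MvPolynomial

/-- `W` is a line (2-dimensional linear subspace of `k⁴`) lying on the surface `V(f) ⊆ P³`. -/
def IsLineOn {k : Type*} [Field k] (f : MvPolynomial (Fin 4) k)
    (W : Submodule k (Fin 4 → k)) : Prop :=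
  Module.finrank k W = 2 ∧ ∀ v ∈ W, MvPolynomial.eval v f = 0

/-- `f` is a nonzero homogeneous polynomial of degree `d` in `k[x,y,z,w]` such that `f` and its
four partial derivatives have no common zero in `k⁴ ∖ {0}`; i.e. `V(f) ⊆ P³` is a smooth
surface of degree `d`. -/
def IsSmoothSurface {k : Type*} [Field k] (f : MvPolynomial (Fin 4) k) (d : ℕ) : Prop :=
  f ≠ 0 ∧ f.IsHomogeneous d ∧
    ∀ v : Fin 4 → k, v ≠ 0 →
      ¬ (MvPolynomial.eval v f = 0 ∧
         ∀ i : Fin 4, MvPolynomial.eval v (MvPolynomial.pderiv i f) = 0)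
/-- The Fermat polynomial `x^(q+1) + y^(q+1) + z^(q+1) + w^(q+1)` in `k[x,y,z,w]`. -/
noncomputable def fermatPoly (k : Type*) [Field k] (q : ℕ) : MvPolynomial (Fin 4) k :=
  X 0 ^ (q + 1) + X 1 ^ (q + 1) + X 2 ^ (q + 1) + X 3 ^ (q + 1)

section Lines

variable {k : Type*} [Field k]

/-- The line of `P³` given by `z = a x + b y`, `w = c x + d y`. -/
def graphLine (a b c d : k) : Submodule k (Fin 4 → k) where
  carrier := {v | v 2 = a * v 0 + b * v 1 ∧ v 3 = c * v 0 + d * v 1}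
  add_mem' := by
    rintro u v ⟨h1, h2⟩ ⟨h3, h4⟩
    constructor
    · simp only [Pi.add_apply, h1, h3]; ring
    · simp only [Pi.add_apply, h2, h4]; ring
  zero_mem' := by simp
  smul_mem' := by
    rintro t v ⟨h1, h2⟩
    constructor
    · simp only [Pi.smul_apply, smul_eq_mul, h1]; ring
    · simp only [Pi.smul_apply, smul_eq_mul, h2]; ring

/-- The line of `P³` given by `y = d x`, `w = b z`. -/
def splitLine (b d : k) : Submodule k (Fin 4 → k) where
  carrier := {v | v 1 = d * v 0 ∧ v 3 = b * v 2}
  add_mem' := by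
    rintro u v ⟨h1, h2⟩ ⟨h3, h4⟩
    constructor
    · simp only [Pi.add_apply, h1, h3]; ring
    · simp only [Pi.add_apply, h2, h4]; ring
  zero_mem' := by simp
  smul_mem' := by
    rintro t v ⟨h1, h2⟩
    constructor
    · simp only [Pi.smul_apply, smul_eq_mul, h1]; ring
    · simp only [Pi.smul_apply, smul_eq_mul, h2]; ring

theorem mem_graphLine {a b c d : k} {v : Fin 4 → k} :
    v ∈ graphLine a b c d ↔ v 2 = a * v 0 + b * v 1 ∧ v 3 = c * v 0 + d * v 1 :=
  Iff.rfl

theorem mem_splitLine {b d : k} {v : Fin 4 → k} :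
    v ∈ splitLine b d ↔ v 1 = d * v 0 ∧ v 3 = b * v 2 :=
  Iff.rfl

theorem finrank_graphLine (a b c d : k) : Module.finrank k (graphLine a b c d) = 2 := by
  let e : graphLine a b c d ≃ₗ[k] k × k :=
    { toFun := fun v => (v.1 0, v.1 1)
      map_add' := fun _ _ => rfl
      map_smul' := fun _ _ => rfl
      invFun := fun s => ⟨![s.1, s.2, a * s.1 + b * s.2, c * s.1 + d * s.2], by
        simp [mem_graphLine]⟩
      left_inv := by
        rintro ⟨v, hv⟩
        rw [mem_graphLine] at hv
        ext i
        fin_cases i <;> simp [hv.1, hv.2]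
      right_inv := fun _ => rfl }
  rw [e.finrank_eq]
  simp

theorem finrank_splitLine (b d : k) : Module.finrank k (splitLine b d) = 2 := by
  let e : splitLine b d ≃ₗ[k] k × k :=
    { toFun := fun v => (v.1 0, v.1 2)
      map_add' := fun _ _ => rfl
      map_smul' := fun _ _ => rfl
      invFun := fun s => ⟨![s.1, d * s.1, s.2, b * s.2], by simp [mem_splitLine]⟩
      left_inv := by
        rintro ⟨v, hv⟩
        rw [mem_splitLine] at hv
        ext i
        fin_cases i <;> simp [hv.1, hv.2]
      right_inv := fun _ => rfl }
  rw [e.finrank_eq]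
  simp

theorem graphLine_inj {a b c d a' b' c' d' : k} (h : graphLine a b c d = graphLine a' b' c' d') :
    a = a' ∧ b = b' ∧ c = c' ∧ d = d' := by
  have h1 : ![1, 0, a, c] ∈ graphLine a' b' c' d' := by
    rw [← h]; simp [mem_graphLine]
  have h2 : ![0, 1, b, d] ∈ graphLine a' b' c' d' := by
    rw [← h]; simp [mem_graphLine]
  simp [mem_graphLine] at h1 h2
  exact ⟨h1.1, h2.1, h1.2, h2.2⟩

theorem splitLine_inj {b d b' d' : k} (h : splitLine b d = splitLine b' d') :
    b = b' ∧ d = d' := by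
  have h1 : ![1, d, 1, b] ∈ splitLine b' d' := by
    rw [← h]; simp [mem_splitLine]
  simp [mem_splitLine] at h1
  exact ⟨h1.2, h1.1⟩

theorem graphLine_ne_splitLine (a b c d b' d' : k) : graphLine a b c d ≠ splitLine b' d' := by
  intro h
  have h1 : ![0, 0, 1, b'] ∈ graphLine a b c d := by
    rw [h]; simp [mem_splitLine]
  simp [mem_graphLine] at h1

/-- The sesquilinear form `∑ uᵢ φ(vᵢ)` attached to a field endomorphism `φ`. -/
def sesqForm (φ : k →+* k) (u v : Fin 4 → k) : k :=
  u 0 * φ (v 0) + u 1 * φ (v 1) + u 2 * φ (v 2) + u 3 * φ (v 3)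

theorem sesqForm_eq_zero_of_isotropic {φ : k →+* k} {r : k} (hr : φ r ≠ r)
    {W : Submodule k (Fin 4 → k)} (hW : ∀ v ∈ W, sesqForm φ v v = 0)
    {u v : Fin 4 → k} (hu : u ∈ W) (hv : v ∈ W) : sesqForm φ u v = 0 := by
  have h1 := hW _ hu
  have h2 := hW _ hv
  have h3 := hW _ (W.add_mem hu hv)
  have h4 := hW _ (W.add_mem hu (W.smul_mem r hv))
  simp only [sesqForm, Pi.add_apply, Pi.smul_apply, smul_eq_mul, map_add, map_mul] at *
  refine (mul_eq_zero.1 ?_).resolve_left (sub_ne_zero.2 hr)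
  linear_combination h4 - r * h3 + (r - 1) * h1 + (r - r * φ r) * h2

/-- The columns of a matrix `A` with `Aᵀ φ(A) = -1` are determined by the first one and a
scalar of norm one. -/
theorem exists_norm_one_of_unitary {φ : k →+* k} {a b c d : k}
    (h1 : a * φ a + c * φ c = -1) (h2 : b * φ a + d * φ c = 0)
    (h3 : a * φ b + c * φ d = 0) (h4 : b * φ b + d * φ d = -1) :
    φ (φ c) = c ∧ ∃ μ, μ * φ μ = 1 ∧ b = -(μ * φ c) ∧ d = μ * φ a := by
  have hb : b = -((b * c - a * d) * φ c) := by linear_combination b * h1 - a * h2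
  have hd : d = (b * c - a * d) * φ a := by linear_combination d * h1 - c * h2
  generalize b * c - a * d = μ at hb hd
  subst hb hd
  have h1' := congrArg φ h1
  simp only [map_add, map_mul, map_neg, map_one] at h1' h3 h4
  have hμ : μ * φ μ = 1 := by linear_combination (-1 : k) * h4 + μ * φ μ * h1'
  have hμ0 : φ μ ≠ 0 := right_ne_zero_of_mul_eq_one hμ
  have h5 : c * φ (φ a) - a * φ (φ c) = 0 := by
    refine (mul_eq_zero.1 ?_).resolve_left hμ0
    linear_combination h3
  refine ⟨?_, μ, hμ, rfl, rfl⟩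
  linear_combination φ (φ c) * h1 - c * h1' + φ a * h5

theorem exists_eq_splitLine {φ : k →+* k} {r : k} (hr : φ r ≠ r)
    {W : Submodule k (Fin 4 → k)} (hdim : Module.finrank k W = 2)
    (hW : ∀ v ∈ W, sesqForm φ v v = 0)
    {v : Fin 4 → k} (hv : v ∈ W) (hv0 : v ≠ 0) (h0 : v 0 = 0) (h1 : v 1 = 0) :
    ∃ b d, b * φ b = -1 ∧ d * φ d = -1 ∧ splitLine b d = W := by
  have hvv := hW v hv
  simp only [sesqForm, h0, h1, zero_mul, zero_add] at hvv
  have h2 : v 2 ≠ 0 := by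
    intro h2
    simp only [h2, zero_mul, zero_add, mul_eq_zero, map_eq_zero, or_self] at hvv
    exact hv0 (by ext i; fin_cases i <;> simp [*])
  have h3 : v 3 ≠ 0 := by
    intro h3
    simp [h3, h2] at hvv
  obtain ⟨u, hu0, hu2⟩ : ∃ u : W, u ≠ 0 ∧ u.1 2 = 0 := by
    have := LinearMap.ker_ne_bot_of_finrank_lt
      (f := (LinearMap.proj 2 : (Fin 4 → k) →ₗ[k] k).comp W.subtype) (by simp [hdim])
    obtain ⟨u, hu, hu0⟩ := Submodule.exists_mem_ne_zero_of_ne_bot this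
    exact ⟨u, hu0, by simpa using hu⟩
  obtain ⟨u, hu⟩ := u
  replace hu0 : u ≠ 0 := fun h => hu0 (Subtype.ext h)
  simp only at hu2
  have huv := sesqForm_eq_zero_of_isotropic hr hW hu hv
  have hu3 : u 3 = 0 := by simpa [sesqForm, h0, h1, hu2, h3] using huv
  have huu := hW u hu
  simp only [sesqForm, hu2, hu3, zero_mul, add_zero] at huu
  have hu0' : u 0 ≠ 0 := by
    intro h
    simp only [h, zero_mul, zero_add, mul_eq_zero, map_eq_zero, or_self] at huu
    exact hu0 (by ext i; fin_cases i <;> simp [*])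
  have hφ2 : φ (v 2) ≠ 0 := by simpa using h2
  have hφ0 : φ (u 0) ≠ 0 := by simpa using hu0'
  refine ⟨v 3 / v 2, u 1 / u 0, ?_, ?_, ?_⟩
  · rw [map_div₀]; field_simp; linear_combination hvv
  · rw [map_div₀]; field_simp; linear_combination huu
  · refine Submodule.eq_of_le_of_finrank_eq ?_ (by rw [finrank_splitLine, hdim])
    rintro x ⟨hx1, hx3⟩
    have : x = (x 0 / u 0) • u + (x 2 / v 2) • v := by
      ext i
      fin_cases i <;> simp [h0, h1, hu2, hu3, hx1, hx3] <;> field_simp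
    rw [this]
    exact W.add_mem (W.smul_mem _ hu) (W.smul_mem _ hv)

theorem exists_eq_graphLine {φ : k →+* k} {r : k} (hr : φ r ≠ r)
    {W : Submodule k (Fin 4 → k)} (hdim : Module.finrank k W = 2)
    (hW : ∀ v ∈ W, sesqForm φ v v = 0)
    (hinj : ∀ v ∈ W, v 0 = 0 → v 1 = 0 → v = 0) :
    ∃ a c μ, φ (φ c) = c ∧ a * φ a + c * φ c = -1 ∧ μ * φ μ = 1 ∧
      graphLine a (-(μ * φ c)) c (μ * φ a) = W := by
  let π : W →ₗ[k] k × k :=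
    ((LinearMap.proj 0 : (Fin 4 → k) →ₗ[k] k).prod (LinearMap.proj 1)).comp W.subtype
  have hπ : Function.Injective π := by
    rw [← LinearMap.ker_eq_bot, LinearMap.ker_eq_bot']
    rintro ⟨v, hv⟩ h
    have h' : v 0 = 0 ∧ v 1 = 0 := Prod.ext_iff.1 h
    exact Subtype.ext (hinj v hv h'.1 h'.2)
  have hsurj := (LinearMap.injective_iff_surjective_of_finrank_eq_finrank
    (by simp [hdim])).1 hπ
  obtain ⟨⟨u, hu⟩, hu'⟩ := hsurj (1, 0)
  obtain ⟨⟨v, hv⟩, hv'⟩ := hsurj (0, 1)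
  obtain ⟨u0, u1⟩ : u 0 = 1 ∧ u 1 = 0 := Prod.ext_iff.1 hu'
  obtain ⟨v0, v1⟩ : v 0 = 0 ∧ v 1 = 1 := Prod.ext_iff.1 hv'
  have huu := hW u hu
  have hvv := hW v hv
  have huv := sesqForm_eq_zero_of_isotropic hr hW hu hv
  have hvu := sesqForm_eq_zero_of_isotropic hr hW hv hu
  simp only [sesqForm, u0, u1, v0, v1, map_zero, map_one, mul_zero, mul_one, add_zero,
    zero_add] at huu hvv huv hvu
  have huu' : u 2 * φ (u 2) + u 3 * φ (u 3) = -1 := by linear_combination huu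
  obtain ⟨hc, μ, hμ, hb, hd⟩ := exists_norm_one_of_unitary huu' hvu huv
    (by linear_combination hvv)
  refine ⟨u 2, u 3, μ, hc, huu', hμ, ?_⟩
  rw [← hb, ← hd]
  refine Submodule.eq_of_le_of_finrank_eq ?_ (by rw [finrank_graphLine, hdim])
  rintro x ⟨hx2, hx3⟩
  have : x = x 0 • u + x 1 • v := by
    ext i
    fin_cases i <;> simp [u0, u1, v0, v1, hx2, hx3] <;> ring
  rw [this]
  exact W.add_mem (W.smul_mem _ hu) (W.smul_mem _ hv)

theorem sesqForm_self_of_mem_splitLine {φ : k →+* k} {b d : k} (hb : b * φ b = -1)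
    (hd : d * φ d = -1) {v : Fin 4 → k} (hv : v ∈ splitLine b d) : sesqForm φ v v = 0 := by
  obtain ⟨h1, h3⟩ := hv
  simp only [sesqForm, h1, h3, map_mul]
  linear_combination v 2 * φ (v 2) * hb + v 0 * φ (v 0) * hd

theorem sesqForm_self_of_mem_graphLine {φ : k →+* k} {a c μ : k} (hc : φ (φ c) = c)
    (h : a * φ a + c * φ c = -1) (hμ : μ * φ μ = 1) {v : Fin 4 → k}
    (hv : v ∈ graphLine a (-(μ * φ c)) c (μ * φ a)) : sesqForm φ v v = 0 := by
  have ha : φ (φ a) = a := by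
    have h' := congrArg φ h
    simp only [map_add, map_mul, map_neg, map_one, hc] at h'
    by_cases ha : a = 0
    · simp [ha]
    · have ha' : φ a ≠ 0 := by simpa using ha
      refine mul_left_cancel₀ ha' ?_
      linear_combination h' - h
  obtain ⟨h2, h3⟩ := hv
  simp only [sesqForm, h2, h3, map_mul, map_add, map_neg, hc, ha]
  linear_combination (v 0 * φ (v 0) + v 1 * φ (v 1) * (μ * φ μ)) * h - v 1 * φ (v 1) * hμ

end Lines

section Counting

variable {k : Type*} [Field k]

theorem card_roots_toFinset_of_separable [IsAlgClosed k] [DecidableEq k] {f : Polynomial k}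
    (hf : f.Separable) :
    f.roots.toFinset.card = f.natDegree := by
  rw [Multiset.toFinset_card_of_nodup (Polynomial.nodup_roots hf),
    (IsAlgClosed.splits f).natDegree_eq_card_roots]

theorem card_nthRootsFinset_of_ne_zero [IsAlgClosed k] {n : ℕ} (hn : (n : k) ≠ 0)
    {t : k} (ht : t ≠ 0) :
    (Polynomial.nthRootsFinset n t).card = n := by
  classical
  rw [Polynomial.nthRootsFinset_def, Polynomial.nthRoots]
  rw [card_roots_toFinset_of_separable (Polynomial.separable_X_pow_sub_C t hn ht),
    Polynomial.natDegree_X_pow_sub_C]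

/-- The elements of `k` fixed by `x ↦ x ^ n`. -/
noncomputable def powFixed (k : Type*) [Field k] (n : ℕ) : Finset k :=
  open Classical in (Polynomial.X ^ n - Polynomial.X : Polynomial k).roots.toFinset

theorem mem_powFixed {n : ℕ} (hn : 1 < n) {x : k} : x ∈ powFixed k n ↔ x ^ n = x := by
  simp [powFixed, Polynomial.mem_roots (FiniteField.X_pow_card_sub_X_ne_zero k hn), sub_eq_zero]

theorem card_powFixed [IsAlgClosed k] (p : ℕ) [CharP k p] {n : ℕ} (hn : 1 < n) (hp : p ∣ n) :
    (powFixed k n).card = n := by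
  classical
  rw [powFixed]
  convert card_roots_toFinset_of_separable (galois_poly_separable (K := k) p n hp)
  exact (FiniteField.X_pow_card_sub_X_natDegree_eq k hn).symm

/-- Pairs `(c, a)` of elements with `c ^ q² = c` and `a ^ (q + 1) + c ^ (q + 1) = -1`. -/
noncomputable def normPairs (k : Type*) [Field k] (q : ℕ) : Finset (Σ _ : k, k) :=
  (powFixed k (q ^ 2)).sigma fun c => Polynomial.nthRootsFinset (q + 1) (-1 - c ^ (q + 1))

theorem card_normPairs [IsAlgClosed k] {p q : ℕ} [CharP k p] (hpq : p ∣ q) (hq : 1 < q)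
    (hneg : (-1 : k) ^ q = -1) :
    (normPairs k q).card = (q + 1) * (q ^ 2 - q) := by
  classical
  have hq0 : (q : k) = 0 := (CharP.cast_eq_zero_iff k p q).2 hpq
  have hq1 : ((q + 1 : ℕ) : k) ≠ 0 := by simp [hq0]
  have hq2 : 1 < q ^ 2 := Nat.one_lt_pow two_ne_zero hq
  set R : Finset k := Polynomial.nthRootsFinset (q + 1) (-1) with hR
  have hmem : ∀ {c : k}, c ∈ R ↔ c ^ (q + 1) = -1 := by
    intro c
    rw [hR, Polynomial.mem_nthRootsFinset (Nat.succ_pos q)]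
  have hRcard : R.card = q + 1 := card_nthRootsFinset_of_ne_zero hq1 (by simp)
  have hsub : R ⊆ powFixed k (q ^ 2) := by
    intro c hc
    rw [hmem] at hc
    have hc0 : c ≠ 0 := by
      rintro rfl
      simp at hc
    rw [mem_powFixed hq2]
    refine mul_right_cancel₀ (pow_ne_zero q hc0) ?_
    calc c ^ q ^ 2 * c ^ q = (c ^ (q + 1)) ^ q := by ring
      _ = c * c ^ q := by rw [hc, hneg, ← hc]; ring
  have hin : ∀ c ∈ R, (Polynomial.nthRootsFinset (q + 1) (-1 - c ^ (q + 1))).card = 1 := by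
    intro c hc
    rw [Finset.card_eq_one]
    refine ⟨0, ?_⟩
    ext a
    rw [Polynomial.mem_nthRootsFinset (Nat.succ_pos q), hmem.1 hc]
    simp
  have hout : ∀ c ∈ powFixed k (q ^ 2) \ R,
      (Polynomial.nthRootsFinset (q + 1) (-1 - c ^ (q + 1))).card = q + 1 := by
    intro c hc
    refine card_nthRootsFinset_of_ne_zero hq1 fun h => (Finset.mem_sdiff.1 hc).2 ?_
    rw [hmem]
    linear_combination -h
  rw [normPairs, Finset.card_sigma, ← Finset.sum_sdiff hsub, Finset.sum_congr rfl hin,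
    Finset.sum_congr rfl hout, Finset.sum_const, Finset.sum_const,
    Finset.card_sdiff_of_subset hsub, hRcard,
    card_powFixed p hq2 (hpq.trans (dvd_pow_self q two_ne_zero))]
  obtain ⟨m, hm⟩ : ∃ m, q ^ 2 = q + 1 + m := Nat.exists_eq_add_of_le (by nlinarith)
  have h1 : q ^ 2 - (q + 1) = m := by omega
  have h2 : q ^ 2 - q = m + 1 := by omega
  rw [h1, h2, smul_eq_mul, smul_eq_mul]
  ring

end Counting

section Fermat

variable {k : Type*} [Field k]

theorem isSmoothSurface_fermatPoly {q : ℕ} (hq0 : q ≠ 0) (hq : (q : k) = 0) :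
    IsSmoothSurface (fermatPoly k q) (q + 1) := by
  refine ⟨?_, ?_, ?_⟩
  · intro h
    have := congrArg (eval ![(1 : k), 0, 0, 0]) h
    simp [fermatPoly] at this
  · exact (((isHomogeneous_X_pow _ _).add (isHomogeneous_X_pow _ _)).add
      (isHomogeneous_X_pow _ _)).add (isHomogeneous_X_pow _ _)
  · rintro v hv ⟨-, h⟩
    refine hv (funext fun i => ?_)
    have hi := h i
    fin_cases i <;> simpa [fermatPoly, pderiv_pow, pderiv_X, Pi.single_apply, hq, hq0] using hi

theorem eval_fermatPoly {φ : k →+* k} {q : ℕ} (hφ : ∀ x, φ x = x ^ q) (v : Fin 4 → k) :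
    eval v (fermatPoly k q) = sesqForm φ v v := by
  simp [fermatPoly, sesqForm, hφ, pow_succ']

/-- The lines on the Fermat surface that are graphs over the `x, y`-plane. -/
noncomputable def fermatGraphLines (k : Type*) [Field k] (q : ℕ) :
    Finset (Submodule k (Fin 4 → k)) :=
  open Classical in (normPairs k q ×ˢ Polynomial.nthRootsFinset (q + 1) (1 : k)).image
    fun s => graphLine s.1.2 (-(s.2 * s.1.1 ^ q)) s.1.1 (s.2 * s.1.2 ^ q)

/-- The lines on the Fermat surface that are not graphs over the `x, y`-plane. -/
noncomputable def fermatSplitLines (k : Type*) [Field k] (q : ℕ) :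
    Finset (Submodule k (Fin 4 → k)) :=
  open Classical in (Polynomial.nthRootsFinset (q + 1) (-1 : k) ×ˢ
    Polynomial.nthRootsFinset (q + 1) (-1 : k)).image fun s => splitLine s.1 s.2

theorem mem_fermatGraphLines {φ : k →+* k} {q : ℕ} (hq : 1 < q) (hφ : ∀ x, φ x = x ^ q)
    {W : Submodule k (Fin 4 → k)} :
    W ∈ fermatGraphLines k q ↔ ∃ a c μ, φ (φ c) = c ∧ a * φ a + c * φ c = -1 ∧ μ * φ μ = 1 ∧
      graphLine a (-(μ * φ c)) c (μ * φ a) = W := by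
  simp only [fermatGraphLines, normPairs, Finset.mem_image, Finset.mem_product, Finset.mem_sigma,
    mem_powFixed (Nat.one_lt_pow two_ne_zero hq), Polynomial.mem_nthRootsFinset (Nat.succ_pos q),
    hφ, ← pow_succ', ← pow_mul, ← sq, eq_sub_iff_add_eq]
  constructor
  · rintro ⟨⟨⟨c, a⟩, μ⟩, ⟨⟨h1, h2⟩, h3⟩, h4⟩
    exact ⟨a, c, μ, h1, h2, h3, h4⟩
  · rintro ⟨a, c, μ, h1, h2, h3, h4⟩
    exact ⟨⟨⟨c, a⟩, μ⟩, ⟨⟨h1, h2⟩, h3⟩, h4⟩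

theorem mem_fermatSplitLines {φ : k →+* k} {q : ℕ} (hφ : ∀ x, φ x = x ^ q)
    {W : Submodule k (Fin 4 → k)} :
    W ∈ fermatSplitLines k q ↔ ∃ b d, b * φ b = -1 ∧ d * φ d = -1 ∧ splitLine b d = W := by
  simp only [fermatSplitLines, Finset.mem_image, Finset.mem_product,
    Polynomial.mem_nthRootsFinset (Nat.succ_pos q), hφ, ← pow_succ', Prod.exists, and_assoc]

theorem isLineOn_fermatPoly_iff {φ : k →+* k} {q : ℕ} (hq : 1 < q) (hφ : ∀ x, φ x = x ^ q)
    {r : k} (hr : φ r ≠ r) {W : Submodule k (Fin 4 → k)} :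
    IsLineOn (fermatPoly k q) W ↔ W ∈ fermatGraphLines k q ∨ W ∈ fermatSplitLines k q := by
  simp only [IsLineOn, eval_fermatPoly hφ, mem_fermatGraphLines hq hφ, mem_fermatSplitLines hφ]
  constructor
  · rintro ⟨hdim, hW⟩
    by_cases hinj : ∀ v ∈ W, v 0 = 0 → v 1 = 0 → v = 0
    · exact Or.inl (exists_eq_graphLine hr hdim hW hinj)
    · push Not at hinj
      obtain ⟨v, hv, h0, h1, hv0⟩ := hinj
      exact Or.inr (exists_eq_splitLine hr hdim hW hv hv0 h0 h1)
  · rintro (⟨a, c, μ, hc, h, hμ, rfl⟩ | ⟨b, d, hb, hd, rfl⟩)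
    · exact ⟨finrank_graphLine _ _ _ _, fun v => sesqForm_self_of_mem_graphLine hc h hμ⟩
    · exact ⟨finrank_splitLine _ _, fun v => sesqForm_self_of_mem_splitLine hb hd⟩

theorem disjoint_fermatGraphLines_fermatSplitLines (q : ℕ) :
    Disjoint (fermatGraphLines k q) (fermatSplitLines k q) := by
  classical
  rw [Finset.disjoint_left]
  intro W h1 h2
  obtain ⟨s, -, rfl⟩ := Finset.mem_image.1 h1
  obtain ⟨t, -, h⟩ := Finset.mem_image.1 h2
  exact graphLine_ne_splitLine _ _ _ _ _ _ h.symm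

theorem card_fermatGraphLines [IsAlgClosed k] {p q : ℕ} [CharP k p] (hpq : p ∣ q) (hq : 1 < q)
    (hneg : (-1 : k) ^ q = -1) :
    (fermatGraphLines k q).card = (q + 1) * (q ^ 2 - q) * (q + 1) := by
  classical
  have hq0 : (q : k) = 0 := (CharP.cast_eq_zero_iff k p q).2 hpq
  rw [fermatGraphLines, Finset.card_image_of_injOn, Finset.card_product,
    card_normPairs hpq hq hneg, card_nthRootsFinset_of_ne_zero (by simp [hq0]) one_ne_zero]
  rintro ⟨⟨c, a⟩, μ⟩ hs ⟨⟨c', a'⟩, μ'⟩ - h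
  obtain ⟨rfl, h1, rfl, h2⟩ := graphLine_inj h
  simp only [normPairs, Finset.coe_product, Set.mem_prod, Finset.mem_coe, Finset.mem_sigma,
    Polynomial.mem_nthRootsFinset (Nat.succ_pos q)] at hs
  obtain ⟨⟨-, ha⟩, -⟩ := hs
  have : μ = μ' := by
    rw [Nat.succ_eq_add_one] at ha
    linear_combination (μ - μ') * ha + c * h1 - a * h2
  rw [this]

theorem card_fermatSplitLines [IsAlgClosed k] {q : ℕ} (hq : (q : k) = 0) :
    (fermatSplitLines k q).card = (q + 1) * (q + 1) := by
  classical
  rw [fermatSplitLines, Finset.card_image_of_injOn, Finset.card_product,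
    card_nthRootsFinset_of_ne_zero (by simp [hq]) (by simp)]
  rintro ⟨b, d⟩ - ⟨b', d'⟩ - h
  obtain ⟨rfl, rfl⟩ := splitLine_inj h
  rfl

end Fermat

theorem fermat_is_smooth_with_maximal_lines {k : Type*} [Field k] [IsAlgClosed k]
    (p e : ℕ) (hp : p.Prime) [CharP k p] (he : 1 ≤ e) (q d : ℕ)
    (hq : q = p ^ e) (hd : d = q + 1) :
    IsSmoothSurface (fermatPoly k q) d ∧
      {W : Submodule k (Fin 4 → k) | IsLineOn (fermatPoly k q) W}.Finite ∧
      {W : Submodule k (Fin 4 → k) | IsLineOn (fermatPoly k q) W}.ncard =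
        d ^ 2 * (d ^ 2 - 3 * d + 3) := by
  classical
  subst hq hd
  have := Fact.mk hp
  have he0 : e ≠ 0 := Nat.one_le_iff_ne_zero.1 he
  have hpq : p ∣ p ^ e := dvd_pow_self p he0
  have hq1 : 1 < p ^ e := Nat.one_lt_pow he0 hp.one_lt
  have hq0 : ((p ^ e : ℕ) : k) = 0 := (CharP.cast_eq_zero_iff k p _).2 hpq
  have hφ : ∀ x : k, iterateFrobenius k p e x = x ^ p ^ e := iterateFrobenius_def p e
  obtain ⟨r, hr⟩ := Infinite.exists_notMem_finset (powFixed k (p ^ e))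
  rw [mem_powFixed hq1, ← hφ] at hr
  have hset : {W : Submodule k (Fin 4 → k) | IsLineOn (fermatPoly k (p ^ e)) W} =
      ↑(fermatGraphLines k (p ^ e) ∪ fermatSplitLines k (p ^ e)) := by
    ext W
    simp [isLineOn_fermatPoly_iff hq1 hφ hr]
  refine ⟨isSmoothSurface_fermatPoly (by omega) hq0, ?_, ?_⟩
  · rw [hset]
    exact Finset.finite_toSet _
  · rw [hset, Set.ncard_coe_finset,
      Finset.card_union_of_disjoint (disjoint_fermatGraphLines_fermatSplitLines _),
      card_fermatGraphLines hpq hq1 (neg_one_pow_char_pow k p e), card_fermatSplitLines hq0]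
    generalize p ^ e = q at hq1
    obtain ⟨m, rfl⟩ := Nat.exists_eq_add_of_lt hq1
    have h1 : (1 + m + 1) ^ 2 - (1 + m + 1) = m ^ 2 + 3 * m + 2 := by
      rw [Nat.sub_eq_iff_eq_add (by nlinarith)]; ring
    have h2 : (1 + m + 1 + 1) ^ 2 - 3 * (1 + m + 1 + 1) = m ^ 2 + 3 * m := by
      rw [Nat.sub_eq_iff_eq_add (by nlinarith)]; ring
    rw [h1, h2]
    ring
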